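/- arXiv:0911.5482 — 4 statements merged into one kernel-verified Lean document; each statement's English description precedes it below -/
import Mathlib

section
/- Let S̃_1,…,S̃_n and Σ̃_1,…,Σ̃_n be symmetric positive semidefinite (p+1)×(p+1) real matrices and set δ = max_i ‖S̃_i − Σ̃_i‖_∞. Let λ > 0, m ≥ 1, and let (β̂_1,…,β̂_n) be a minimizer over (β_1,…,β_n) ∈ (ℝ^p)^n of Σ_{i=1}^n [ m β̃_i^T S̃_i β̃_i + λ ‖β̃_i‖_1² ]. Then for arbitrary vectors β_{01},…,β_{0n} ∈ ℝ^p: Σ_{i=1}^n β̂̃_i^T Σ̃_i β̂̃_i ≤ Σ_{i=1}^n β̃_{0i}^T Σ̃_i β̃_{0i} + (λ/m + δ) Σ_{i=1}^n ‖β̃_{0i}‖_1² − (λ/m − δ) Σ_{i=1}^n ‖β̂̃_i‖_1². -/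
open Matrix

/-- ℓ1 norm of a vector. -/
noncomputable def l1 {q : ℕ} (v : Fin q → ℝ) : ℝ := ∑ ℓ, |v ℓ|

/-- `β̃ = (−1, βᵀ)ᵀ`. -/
noncomputable def tl {p : ℕ} (v : Fin p → ℝ) : Fin (p + 1) → ℝ := Fin.cons (-1) v

/-- Quadratic form `vᵀ S v`. -/
noncomputable def qf {q : ℕ} (S : Matrix (Fin q) (Fin q) ℝ) (v : Fin q → ℝ) : ℝ :=
  v ⬝ᵥ S.mulVec v

/-- Maximal absolute value of an entry of a matrix. -/
noncomputable def supNorm {a b : ℕ} (A : Matrix (Fin a) (Fin b) ℝ) : ℝ :=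
  ⨆ kl : Fin a × Fin b, |A kl.1 kl.2|

theorem qf_sub_le {q : ℕ} (A B : Matrix (Fin q) (Fin q) ℝ) (v : Fin q → ℝ) (δ : ℝ)
    (h : supNorm (A - B) ≤ δ) : |qf A v - qf B v| ≤ δ * (l1 v) ^ 2 := by
  have he : ∀ k l, |A k l - B k l| ≤ δ := fun k l =>
    le_trans (le_ciSup (f := fun kl : Fin q × Fin q => |(A - B) kl.1 kl.2|)
      (Set.finite_range _).bddAbove (k, l)) h
  have h1 : qf A v - qf B v = ∑ k, ∑ l, v k * ((A k l - B k l) * v l) := by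
    simp only [qf, dotProduct, Matrix.mulVec, Finset.mul_sum]
    rw [← Finset.sum_sub_distrib]
    refine Finset.sum_congr rfl fun k _ => ?_
    rw [← Finset.sum_sub_distrib]
    refine Finset.sum_congr rfl fun l _ => ?_
    ring
  have h2 : δ * (l1 v) ^ 2 = ∑ k, ∑ l, |v k| * (δ * |v l|) := by
    rw [l1, sq, Finset.sum_mul_sum]
    simp only [Finset.mul_sum]
    refine Finset.sum_congr rfl fun k _ => Finset.sum_congr rfl fun l _ => ?_
    ring
  rw [h1, h2]
  refine (Finset.abs_sum_le_sum_abs _ _).trans (Finset.sum_le_sum fun k _ => ?_)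
  refine (Finset.abs_sum_le_sum_abs _ _).trans (Finset.sum_le_sum fun l _ => ?_)
  rw [abs_mul, abs_mul]
  have := he k l
  gcongr

theorem stmt2 {n p : ℕ} (m : ℕ) (hm : 1 ≤ m) (lam : ℝ) (hlam : 0 < lam)
    (S Sg : Fin n → Matrix (Fin (p + 1)) (Fin (p + 1)) ℝ)
    (hS : ∀ i, (S i).PosSemidef) (hSg : ∀ i, (Sg i).PosSemidef)
    (δ : ℝ) (hδ : δ = ⨆ i : Fin n, supNorm (S i - Sg i))
    (βhat : Fin n → Fin p → ℝ)
    (hmin : ∀ b : Fin n → Fin p → ℝ,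
      (∑ i, ((m : ℝ) * qf (S i) (tl (βhat i)) + lam * (l1 (tl (βhat i))) ^ 2)) ≤
      (∑ i, ((m : ℝ) * qf (S i) (tl (b i)) + lam * (l1 (tl (b i))) ^ 2)))
    (β0 : Fin n → Fin p → ℝ) :
    ∑ i, qf (Sg i) (tl (βhat i)) ≤
      (∑ i, qf (Sg i) (tl (β0 i)))
        + (lam / m + δ) * ∑ i, (l1 (tl (β0 i))) ^ 2
        - (lam / m - δ) * ∑ i, (l1 (tl (βhat i))) ^ 2 := by
  have hb : ∀ i, supNorm (S i - Sg i) ≤ δ := fun i => by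
    rw [hδ]
    exact le_ciSup (f := fun i => supNorm (S i - Sg i)) (Set.finite_range _).bddAbove i
  have hm0 : (0 : ℝ) < m := by exact_mod_cast hm
  have h1 : ∑ i, qf (Sg i) (tl (βhat i)) ≤
      ∑ i, (qf (S i) (tl (βhat i)) + δ * (l1 (tl (βhat i))) ^ 2) :=
    Finset.sum_le_sum fun i _ => by
      have := (abs_le.1 (qf_sub_le _ _ (tl (βhat i)) δ (hb i))).1
      linarith
  have h2 : ∑ i, qf (S i) (tl (β0 i)) ≤
      ∑ i, (qf (Sg i) (tl (β0 i)) + δ * (l1 (tl (β0 i))) ^ 2) :=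
    Finset.sum_le_sum fun i _ => by
      have := (abs_le.1 (qf_sub_le _ _ (tl (β0 i)) δ (hb i))).2
      linarith
  have h3 := hmin β0
  simp only [Finset.sum_add_distrib, ← Finset.mul_sum] at h1 h2 h3
  have h4 := div_le_div_of_nonneg_right h3 hm0.le
  simp only [add_div, mul_div_right_comm, div_self hm0.ne', one_mul] at h4
  linarith
end

section
/- Let S̃_1,…,S̃_n and Σ̃_1,…,Σ̃_n be symmetric positive semidefinite (p+1)×(p+1) real matrices, δ = max_i ‖S̃_i − Σ̃_i‖_∞, and let (β̂_1,…,β̂_n) minimize Σ_{i=1}^n [ m β̃_i^T S̃_i β̃_i + λ ‖β̃_i‖_1² ] over (ℝ^p)^n. Let β_{01},…,β_{0n} ∈ ℝ^p be arbitrary, C_n = n^{-1} Σ_{i=1}^n β̃_{0i}^T Σ̃_i β̃_{0i}, and c_n = n^{-1} Σ_{i=1}^n inf_{β∈ℝ^p} β̃^T Σ̃_i β̃. If λ > mδ, then Σ_{i=1}^n ‖β̂̃_i‖_1² ≤ mn(C_n − c_n)/(λ − mδ) + ((λ + mδ)/(λ − mδ)) Σ_{i=1}^n ‖β̃_{0i}‖_1².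 -/
open Matrix

lemma abs_le_supNorm {a b : ℕ} (A : Matrix (Fin a) (Fin b) ℝ) (k : Fin a) (l : Fin b) :
    |A k l| ≤ supNorm A :=
  le_ciSup (f := fun kl : Fin a × Fin b => |A kl.1 kl.2|) (Set.finite_range _).bddAbove (k, l)

lemma qf_diff {q : ℕ} (A B : Matrix (Fin q) (Fin q) ℝ) (d : ℝ)
    (h : supNorm (A - B) ≤ d) (v : Fin q → ℝ) :
    |qf A v - qf B v| ≤ d * (l1 v) ^ 2 := by
  have e : qf A v - qf B v = ∑ k, ∑ l, v k * ((A - B) k l * v l) := by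
    simp only [qf, dotProduct, mulVec, Finset.mul_sum, Matrix.sub_apply,
      ← Finset.sum_sub_distrib]
    refine Finset.sum_congr rfl fun k _ => Finset.sum_congr rfl fun l _ => by ring
  have e2 : d * (l1 v) ^ 2 = ∑ k, ∑ l, d * (|v k| * |v l|) := by
    rw [l1, sq, Finset.sum_mul_sum]
    simp only [Finset.mul_sum]
  rw [e, e2]
  refine (Finset.abs_sum_le_sum_abs _ _).trans (Finset.sum_le_sum fun k _ => ?_)
  refine (Finset.abs_sum_le_sum_abs _ _).trans (Finset.sum_le_sum fun l _ => ?_)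
  rw [abs_mul, abs_mul]
  have h1 := (abs_le_supNorm (A - B) k l).trans h
  have h2 := mul_le_mul_of_nonneg_right h1 (mul_nonneg (abs_nonneg (v k)) (abs_nonneg (v l)))
  linarith

theorem stmt3 {n p : ℕ} (m : ℕ) (hm : 1 ≤ m) (lam : ℝ) (hlam : 0 < lam)
    (S Sg : Fin n → Matrix (Fin (p + 1)) (Fin (p + 1)) ℝ)
    (hS : ∀ i, (S i).PosSemidef) (hSg : ∀ i, (Sg i).PosSemidef)
    (δ : ℝ) (hδ : δ = ⨆ i : Fin n, supNorm (S i - Sg i))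
    (βhat : Fin n → Fin p → ℝ)
    (hmin : ∀ b : Fin n → Fin p → ℝ,
      (∑ i, ((m : ℝ) * qf (S i) (tl (βhat i)) + lam * (l1 (tl (βhat i))) ^ 2)) ≤
      (∑ i, ((m : ℝ) * qf (S i) (tl (b i)) + lam * (l1 (tl (b i))) ^ 2)))
    (β0 : Fin n → Fin p → ℝ)
    (Cn cn : ℝ)
    (hC : Cn = (n : ℝ)⁻¹ * ∑ i, qf (Sg i) (tl (β0 i)))
    (hc : cn = (n : ℝ)⁻¹ * ∑ i, ⨅ β : Fin p → ℝ, qf (Sg i) (tl β))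
    (hgap : (m : ℝ) * δ < lam) :
    ∑ i, (l1 (tl (βhat i))) ^ 2 ≤
      (m : ℝ) * n * (Cn - cn) / (lam - m * δ)
        + ((lam + m * δ) / (lam - m * δ)) * ∑ i, (l1 (tl (β0 i))) ^ 2 := by
  have hd : ∀ i, supNorm (S i - Sg i) ≤ δ := fun i => by
    rw [hδ]
    exact le_ciSup (f := fun i => supNorm (S i - Sg i)) (Set.finite_range _).bddAbove i
  have hpos : 0 < lam - m * δ := by linarith
  have hm0 : (0 : ℝ) ≤ m := Nat.cast_nonneg m
  have hinf : ∀ i, (⨅ β : Fin p → ℝ, qf (Sg i) (tl β)) ≤ qf (Sg i) (tl (βhat i)) := fun i => by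
    refine ciInf_le ⟨0, ?_⟩ (βhat i)
    rintro _ ⟨b, rfl⟩
    have := (hSg i).dotProduct_mulVec_nonneg (tl b)
    simpa [qf] using this
  have hA : (m : ℝ) * n * (Cn - cn) =
      ∑ i, (m : ℝ) * (qf (Sg i) (tl (β0 i)) - ⨅ β : Fin p → ℝ, qf (Sg i) (tl β)) := by
    rcases Nat.eq_zero_or_pos n with h | h
    · subst h; simp
    · have hn : (n : ℝ) ≠ 0 := by positivity
      rw [hC, hc, ← Finset.mul_sum, Finset.sum_sub_distrib]
      field_simp
  rw [div_mul_eq_mul_div, ← add_div, le_div_iff₀ hpos, hA, Finset.mul_sum,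
    ← Finset.sum_add_distrib, Finset.sum_mul]
  have key := hmin β0
  rw [← sub_nonneg, ← Finset.sum_sub_distrib] at key ⊢
  refine key.trans (Finset.sum_le_sum fun i _ => ?_)
  have h1 := mul_le_mul_of_nonneg_left
    (abs_le.1 (qf_diff (S i) (Sg i) δ (hd i) (tl (βhat i)))).1 hm0
  have h2 := mul_le_mul_of_nonneg_left
    (abs_le.1 (qf_diff (S i) (Sg i) δ (hd i) (tl (β0 i)))).2 hm0
  have h3 := mul_le_mul_of_nonneg_left (hinf i) hm0
  linarith
end

section
/- Let S̃_1,…,S̃_n and Σ̃_1,…,Σ̃_n be symmetric positive semidefinite (p+1)×(p+1) real matrices and δ = max_i ‖S̃_i − Σ̃_i‖_∞. Let α > 2, λ > 0, and let (β̂_1,…,β̂_n) be a minimizer over (ℝ^p)^n of Σ_{i=1}^n [ m β̃_i^T S̃_i β̃_i + λ ‖β̃_i‖_1^α ]. For each i let β_{0i} ∈ ℝ^p minimize β ↦ β̃^T Σ̃_i β̃ over ℝ^p. Then Σ_{i=1}^n ( λ ‖β̂̃_i‖_1^α − m δ ‖β̂̃_i‖_1² ) ≤ λ Σ_{i=1}^n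 ‖β̃_{0i}‖_1^α + m δ Σ_{i=1}^n ‖β̃_{0i}‖_1². -/
open Matrix

theorem aux_qf {q : ℕ} (A B : Matrix (Fin q) (Fin q) ℝ) (v : Fin q → ℝ) (δ : ℝ)
    (h : ∀ k l, |A k l - B k l| ≤ δ) : |qf A v - qf B v| ≤ δ * (l1 v) ^ 2 := by
  have e : qf A v - qf B v = ∑ k, ∑ l, v k * ((A k l - B k l) * v l) := by
    simp only [qf, dotProduct, Matrix.mulVec, Finset.mul_sum, ← Finset.sum_sub_distrib]
    refine Finset.sum_congr rfl fun k _ => Finset.sum_congr rfl fun l _ => ?_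
    ring
  have e2 : δ * (l1 v) ^ 2 = ∑ k, ∑ l, |v k| * (δ * |v l|) := by
    rw [l1, sq, Finset.sum_mul_sum, Finset.mul_sum]
    refine Finset.sum_congr rfl fun k _ => ?_
    rw [Finset.mul_sum]
    refine Finset.sum_congr rfl fun l _ => ?_
    ring
  rw [e, e2]
  refine (Finset.abs_sum_le_sum_abs _ _).trans (Finset.sum_le_sum fun k _ => ?_)
  refine (Finset.abs_sum_le_sum_abs _ _).trans (Finset.sum_le_sum fun l _ => ?_)
  rw [abs_mul, abs_mul]
  have := h k l
  gcongr

theorem stmt4 {n p : ℕ} (m : ℕ) (hm : 1 ≤ m) (α lam : ℝ) (hα : 2 < α) (hlam : 0 < lam)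
    (S Sg : Fin n → Matrix (Fin (p + 1)) (Fin (p + 1)) ℝ)
    (hS : ∀ i, (S i).PosSemidef) (hSg : ∀ i, (Sg i).PosSemidef)
    (δ : ℝ) (hδ : δ = ⨆ i : Fin n, supNorm (S i - Sg i))
    (βhat : Fin n → Fin p → ℝ)
    (hmin : ∀ b : Fin n → Fin p → ℝ,
      (∑ i, ((m : ℝ) * qf (S i) (tl (βhat i)) + lam * (l1 (tl (βhat i))) ^ α)) ≤
      (∑ i, ((m : ℝ) * qf (S i) (tl (b i)) + lam * (l1 (tl (b i))) ^ α)))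
    (β0 : Fin n → Fin p → ℝ)
    (hβ0 : ∀ i, ∀ β : Fin p → ℝ, qf (Sg i) (tl (β0 i)) ≤ qf (Sg i) (tl β)) :
    ∑ i, (lam * (l1 (tl (βhat i))) ^ α - (m : ℝ) * δ * (l1 (tl (βhat i))) ^ 2) ≤
      lam * (∑ i, (l1 (tl (β0 i))) ^ α) + (m : ℝ) * δ * ∑ i, (l1 (tl (β0 i))) ^ 2 := by
  have hd : ∀ i k l, |S i k l - Sg i k l| ≤ δ := by
    intro i k l
    have h1 : |S i k l - Sg i k l| ≤ supNorm (S i - Sg i) :=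
      le_ciSup (f := fun kl : Fin (p+1) × Fin (p+1) => |(S i - Sg i) kl.1 kl.2|)
        (Set.finite_range _).bddAbove (k, l)
    have h2 : supNorm (S i - Sg i) ≤ δ := by
      rw [hδ]
      exact le_ciSup (f := fun i => supNorm (S i - Sg i)) (Set.finite_range _).bddAbove i
    exact h1.trans h2
  have h0 := hmin β0
  have hm0 : (0 : ℝ) ≤ m := Nat.cast_nonneg m
  have key : ∑ i, (m : ℝ) * qf (S i) (tl (β0 i)) ≤
      ∑ i, ((m : ℝ) * qf (S i) (tl (βhat i)) + ((m : ℝ) * δ * (l1 (tl (βhat i))) ^ 2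
        + (m : ℝ) * δ * (l1 (tl (β0 i))) ^ 2)) := by
    refine Finset.sum_le_sum fun i _ => ?_
    have a1 := abs_le.1 (aux_qf (S i) (Sg i) (tl (β0 i)) δ (hd i))
    have a2 := abs_le.1 (aux_qf (S i) (Sg i) (tl (βhat i)) δ (hd i))
    have a3 := hβ0 i (βhat i)
    have : qf (S i) (tl (β0 i)) ≤ qf (S i) (tl (βhat i)) + (δ * (l1 (tl (βhat i))) ^ 2
        + δ * (l1 (tl (β0 i))) ^ 2) := by linarith [a1.2, a2.1]
    calc _ ≤ (m : ℝ) * _ := mul_le_mul_of_nonneg_left this hm0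
      _ = _ := by ring
  simp only [Finset.sum_add_distrib, Finset.sum_sub_distrib, Finset.mul_sum] at *
  linarith
end

section
/- Let B ∈ ℝ^{p×n} be a matrix whose rows are pairwise orthogonal vectors in ℝ^n. Then for every orthogonal matrix U ∈ O(p): ‖B‖_{2,1} ≤ ‖UB‖_{2,1}. -/
open Matrix

/-- The `ℓ_{2,1}` norm of `B`: the sum of Euclidean norms of the rows. -/
noncomputable def rowNorm21 {p n : ℕ} (B : Matrix (Fin p) (Fin n) ℝ) : ℝ :=
  ∑ ℓ, Real.sqrt (∑ i, (B ℓ i) ^ 2)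

theorem stmt13 {p n : ℕ} (B : Matrix (Fin p) (Fin n) ℝ)
    (horth : ∀ ℓ ℓ' : Fin p, ℓ ≠ ℓ' → ∑ i, B ℓ i * B ℓ' i = 0)
    (U : Matrix (Fin p) (Fin p) ℝ) (hU : Uᵀ * U = 1) :
    rowNorm21 B ≤ rowNorm21 (U * B) := by
  have hU' : U * Uᵀ = 1 := mul_eq_one_comm.mp hU
  have hcol : ∀ l, ∑ k, U k l ^ 2 = 1 := by
    intro l
    have h := congrFun (congrFun hU l) l
    simp only [Matrix.mul_apply, Matrix.transpose_apply, Matrix.one_apply_eq] at h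
    simpa [pow_two] using h
  have hrow : ∀ k, ∑ l, U k l ^ 2 = 1 := by
    intro k
    have h := congrFun (congrFun hU' k) k
    simp only [Matrix.mul_apply, Matrix.transpose_apply, Matrix.one_apply_eq] at h
    simpa [pow_two] using h
  have hsq : ∀ k, ∑ i, ((U * B) k i) ^ 2 = ∑ l, U k l ^ 2 * ∑ i, B l i ^ 2 := by
    intro k
    calc ∑ i, ((U * B) k i) ^ 2
        = ∑ i, ∑ l, ∑ m, (U k l * U k m) * (B l i * B m i) := by
          refine Finset.sum_congr rfl fun i _ => ?_
          rw [Matrix.mul_apply, pow_two, Finset.sum_mul_sum]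
          refine Finset.sum_congr rfl fun l _ => Finset.sum_congr rfl fun m _ => ?_
          ring
      _ = ∑ l, ∑ m, (U k l * U k m) * ∑ i, B l i * B m i := by
          rw [Finset.sum_comm]
          refine Finset.sum_congr rfl fun l _ => ?_
          rw [Finset.sum_comm]
          refine Finset.sum_congr rfl fun m _ => ?_
          rw [Finset.mul_sum]
      _ = ∑ l, U k l ^ 2 * ∑ i, B l i ^ 2 := by
          refine Finset.sum_congr rfl fun l _ => ?_
          rw [Finset.sum_eq_single l]
          · simp only [pow_two]
          · intro m _ hm
            rw [horth l m (Ne.symm hm), mul_zero]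
          · simp
  unfold rowNorm21
  calc ∑ l, Real.sqrt (∑ i, B l i ^ 2)
      = ∑ l, ∑ k, U k l ^ 2 * Real.sqrt (∑ i, B l i ^ 2) := by
        refine Finset.sum_congr rfl fun l _ => ?_
        rw [← Finset.sum_mul, hcol, one_mul]
    _ = ∑ k, ∑ l, U k l ^ 2 * Real.sqrt (∑ i, B l i ^ 2) := Finset.sum_comm
    _ ≤ ∑ k, Real.sqrt (∑ i, ((U * B) k i) ^ 2) := by
        refine Finset.sum_le_sum fun k _ => Real.le_sqrt_of_sq_le ?_
        have h := Finset.sum_mul_sq_le_sq_mul_sq Finset.univ (fun l => U k l)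
          (fun l => U k l * Real.sqrt (∑ i, B l i ^ 2))
        rw [hrow, one_mul] at h
        rw [hsq]
        calc _ = (∑ l, U k l * (U k l * Real.sqrt (∑ i, B l i ^ 2))) ^ 2 := by
              congr 1
              refine Finset.sum_congr rfl fun l _ => ?_
              ring
          _ ≤ _ := h
          _ = _ := by
              refine Finset.sum_congr rfl fun l _ => ?_
              rw [mul_pow, Real.sq_sqrt (Finset.sum_nonneg fun i _ => sq_nonneg _)]
end
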